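/- In the group ℤ² with generating set {a, b, c, d} where a = (1,0), b = (0,1), c = (1,1), d = (2,2), for every n ≥ 1 the word a^n (respectively b^n, d^n) is the unique geodesic word representing the element (n,0) (respectively (0,n), (2n,2n)); in particular the word length of (2n,2n) with respect to this generating set is n. Consequently, the cyclic subgroups ⟨a⟩, ⟨b⟩ and ⟨d⟩ are totally geodesic in (ℤ², {a,b,c,d}), and since |a| = |b| = |d| = 1, the presentation of Wise's group as a multiple HNN extension associating ⟨a⟩ with ⟨d⟩ and ⟨b⟩ with ⟨d⟩ is strip equidistant. -/

import Mathlib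

/-!  Common framework: words over an inverse-closed generating set, word length,
geodesics, falsification by fellow traveler property, almost convexity. -/

namespace ACPaper

section Core

variable {β G : Type*} [Group G]

/-- A letter is a generator (`Sum.inl`) or the formal inverse of a generator (`Sum.inr`);
this realizes the inverse-closed alphabet `X^{±1}`. -/
def letterEval (gen : β → G) : β ⊕ β → G :=
  Sum.elim gen fun b => (gen b)⁻¹

/-- Evaluation of a word over `X^{±1}` in the group. -/
def eval (gen : β → G) (w : List (β ⊕ β)) : G :=
  (w.map (letterEval gen)).prod

/-- `gen` is a generating set: every element is represented by some word. -/
def Generates (gen : β → G) : Prop :=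
  ∀ g : G, ∃ w : List (β ⊕ β), eval gen w = g

/-- Word length of a group element with respect to the generating set. -/
noncomputable def wlen (gen : β → G) (g : G) : ℕ :=
  sInf {n : ℕ | ∃ w : List (β ⊕ β), eval gen w = g ∧ w.length = n}

/-- A word is geodesic if its length equals the word length of the element it represents. -/
def IsGeodesic (gen : β → G) (w : List (β ⊕ β)) : Prop :=
  w.length = wlen gen (eval gen w)

/-- The point reached after `t` steps along the unit-speed path labelled by `w`
(the path remains at its endpoint after time `w.length`). -/
def pos (gen : β → G) (w : List (β ⊕ β)) (t : ℕ) : G :=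
  eval gen (w.take t)

/-- Synchronous falsification by fellow traveler property with constant `k`:
every non-geodesic word is synchronously `k`-fellow traveled by a shorter word
representing the same element. -/
def SynchFFTP (gen : β → G) (k : ℕ) : Prop :=
  ∀ w : List (β ⊕ β), ¬ IsGeodesic gen w →
    ∃ w' : List (β ⊕ β), eval gen w' = eval gen w ∧ w'.length < w.length ∧
      ∀ t : ℕ, wlen gen ((pos gen w t)⁻¹ * pos gen w' t) ≤ k

/-- The path starting at `g` labelled by the word `w` stays in the ball of radius `N`
about the identity. -/
def PathInBall (gen : β → G) (N : ℕ) (g : G) (w : List (β ⊕ β)) : Prop :=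
  ∀ t : ℕ, wlen gen (g * pos gen w t) ≤ N

/-- Almost convexity with constant `C`: any two elements of the sphere of radius `N ≥ 1`
at distance at most `2` are joined by a path of length at most `C` inside the ball of
radius `N`. -/
def AlmostConvexWith (gen : β → G) (C : ℕ) : Prop :=
  ∀ N : ℕ, 1 ≤ N → ∀ g g' : G, wlen gen g = N → wlen gen g' = N →
    wlen gen (g⁻¹ * g') ≤ 2 →
    ∃ w : List (β ⊕ β), g * eval gen w = g' ∧ w.length ≤ C ∧ PathInBall gen N g w

/-- Almost convexity: almost convex with some positive constant. -/
def AlmostConvex (gen : β → G) : Prop :=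
  ∃ C : ℕ, 0 < C ∧ AlmostConvexWith gen C

end Core


/-- Every geodesic word (over `X^{±1}`) representing an element of the subgroup generated
by `gens` is a concatenation of geodesic words, each representing an element of `gens` or
an inverse of one. -/
def TGConcat {β G : Type*} [Group G] (gen : β → G) (gens : Set G) : Prop :=
  ∀ w : List (β ⊕ β), IsGeodesic gen w → eval gen w ∈ Subgroup.closure gens →
    ∃ ps : List (List (β ⊕ β)), w = ps.flatten ∧
      ∀ p ∈ ps, IsGeodesic gen p ∧ ∃ g ∈ gens, eval gen p = g ∨ eval gen p = g⁻¹

/-- The generating set `{a, b, c, d}` of `ℤ²` (written multiplicatively), where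
`a = (1,0)`, `b = (0,1)`, `c = (1,1)`, `d = (2,2)`. -/
def genZ : Fin 4 → Multiplicative (ℤ × ℤ) :=
  ![Multiplicative.ofAdd ((1, 0) : ℤ × ℤ), Multiplicative.ofAdd ((0, 1) : ℤ × ℤ),
    Multiplicative.ofAdd ((1, 1) : ℤ × ℤ), Multiplicative.ofAdd ((2, 2) : ℤ × ℤ)]

section Peak

variable {β G : Type*} [Group G] {gen : β → G}

theorem wlen_eval_le (gen : β → G) (w : List (β ⊕ β)) : wlen gen (eval gen w) ≤ w.length :=
  Nat.sInf_le ⟨w, rfl, rfl⟩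

theorem exists_eval_eq_length_eq_wlen (gen : β → G) (w : List (β ⊕ β)) :
    ∃ v : List (β ⊕ β), eval gen v = eval gen w ∧ v.length = wlen gen (eval gen w) :=
  Nat.sInf_mem (s := {n : ℕ | ∃ v : List (β ⊕ β), eval gen v = eval gen w ∧ v.length = n})
    ⟨w.length, w, rfl, rfl⟩

theorem eval_replicate (gen : β → G) (n : ℕ) (l : β ⊕ β) :
    eval gen (List.replicate n l) = letterEval gen l ^ n := by
  simp [eval]

theorem letterEval_swap (gen : β → G) (l : β ⊕ β) :
    letterEval gen l.swap = (letterEval gen l)⁻¹ := by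
  cases l <;> simp [letterEval]

/-- The letter `l` is the unique maximizer, among all letters, of some homomorphism to `ℤ`. -/
def IsPeak (gen : β → G) (l : β ⊕ β) : Prop :=
  ∃ f : G →* Multiplicative ℤ, 0 < (f (letterEval gen l)).toAdd ∧
    ∀ m, m ≠ l → (f (letterEval gen m)).toAdd < (f (letterEval gen l)).toAdd

theorem IsPeak.swap {l : β ⊕ β} (h : IsPeak gen l) : IsPeak gen l.swap := by
  obtain ⟨f, hpos, hlt⟩ := h
  refine ⟨f⁻¹, by simpa [letterEval_swap] using hpos, fun m hm => ?_⟩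
  have := hlt m.swap fun e => hm (by rw [← e, Sum.swap_swap])
  simpa [letterEval_swap] using this

theorem toAdd_eval_le (f : G →* Multiplicative ℤ) {l : β ⊕ β}
    (hlt : ∀ m, m ≠ l → (f (letterEval gen m)).toAdd < (f (letterEval gen l)).toAdd)
    (w : List (β ⊕ β)) :
    (f (eval gen w)).toAdd ≤ w.length * (f (letterEval gen l)).toAdd ∧
      ((f (eval gen w)).toAdd = w.length * (f (letterEval gen l)).toAdd →
        w = List.replicate w.length l) := by
  induction w with
  | nil => simp [eval]
  | cons m w ih =>
    obtain ⟨hle, heq⟩ := ih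
    have hcons : (f (eval gen (m :: w))).toAdd =
        (f (letterEval gen m)).toAdd + (f (eval gen w)).toAdd := by simp [eval]
    rw [hcons, List.length_cons, Nat.cast_succ, add_one_mul]
    by_cases hm : m = l
    · subst hm
      refine ⟨by linarith, fun h => ?_⟩
      rw [List.replicate_succ, ← heq (by linarith)]
    · have := hlt m hm
      exact ⟨by linarith, fun h => absurd h (by linarith)⟩

theorem IsPeak.eq_replicate {l : β ⊕ β} (h : IsPeak gen l) {n : ℕ} {w : List (β ⊕ β)}
    (hw : eval gen w = letterEval gen l ^ n) (hlen : w.length ≤ n) :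
    w = List.replicate n l := by
  obtain ⟨f, hpos, hlt⟩ := h
  obtain ⟨hle, heq⟩ := toAdd_eval_le f hlt w
  have hval : (f (eval gen w)).toAdd = n * (f (letterEval gen l)).toAdd := by simp [hw]
  rw [hval] at hle heq
  have hn : n = w.length :=
    le_antisymm (by exact_mod_cast le_of_mul_le_mul_right hle hpos) hlen
  rw [← hn] at heq
  exact heq rfl

theorem IsPeak.wlen_pow {l : β ⊕ β} (h : IsPeak gen l) (n : ℕ) :
    wlen gen (letterEval gen l ^ n) = n := by
  obtain ⟨v, hv, hlen⟩ := exists_eval_eq_length_eq_wlen gen (List.replicate n l)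
  have hle := wlen_eval_le gen (List.replicate n l)
  rw [List.length_replicate] at hle
  rw [eval_replicate] at hv hlen hle
  rw [← hlen, h.eq_replicate hv (hlen.trans_le hle), List.length_replicate]

theorem IsPeak.isGeodesic_replicate {l : β ⊕ β} (h : IsPeak gen l) (n : ℕ) :
    IsGeodesic gen (List.replicate n l) := by
  rw [IsGeodesic, eval_replicate, h.wlen_pow, List.length_replicate]

theorem IsPeak.eq_replicate_of_isGeodesic {l : β ⊕ β} (h : IsPeak gen l) {n : ℕ}
    {w : List (β ⊕ β)} (hw : IsGeodesic gen w) (he : eval gen w = letterEval gen l ^ n) :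
    w = List.replicate n l :=
  h.eq_replicate he (by rw [hw, he, h.wlen_pow])

theorem IsPeak.tgConcat {b : β} (h : IsPeak gen (Sum.inl b)) : TGConcat gen {gen b} := by
  have key : ∀ l : β ⊕ β, IsPeak gen l →
      (letterEval gen l = gen b ∨ letterEval gen l = (gen b)⁻¹) → ∀ (n : ℕ),
      ∃ ps : List (List (β ⊕ β)), List.replicate n l = ps.flatten ∧
        ∀ p ∈ ps, IsGeodesic gen p ∧
          ∃ g ∈ ({gen b} : Set G), eval gen p = g ∨ eval gen p = g⁻¹ := by
    intro l hl hb n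
    refine ⟨List.replicate n (List.replicate 1 l), by simp, fun p hp => ?_⟩
    rw [List.eq_of_mem_replicate hp]
    refine ⟨hl.isGeodesic_replicate 1, gen b, rfl, ?_⟩
    simpa only [eval_replicate, pow_one] using hb
  intro w hw hmem
  obtain ⟨k, hk⟩ := Subgroup.mem_closure_singleton.1 hmem
  obtain ⟨n, rfl | rfl⟩ := k.eq_nat_or_neg
  · rw [h.eq_replicate_of_isGeodesic hw (n := n) (by simpa [letterEval] using hk.symm)]
    exact key _ h (Or.inl rfl) n
  · rw [h.swap.eq_replicate_of_isGeodesic hw (n := n) (by simpa [letterEval] using hk.symm)]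
    exact key _ h.swap (Or.inr rfl) n

end Peak

/-- The homomorphism `(x, y) ↦ p * x + q * y` on the multiplicatively written `ℤ²`. -/
def linearForm (p q : ℤ) : Multiplicative (ℤ × ℤ) →* Multiplicative ℤ :=
  AddMonoidHom.toMultiplicative (p • AddMonoidHom.fst ℤ ℤ + q • AddMonoidHom.snd ℤ ℤ)

theorem isPeak_genZ_zero : IsPeak genZ (Sum.inl 0) :=
  ⟨linearForm 4 (-3), by decide, by decide⟩

theorem isPeak_genZ_one : IsPeak genZ (Sum.inl 1) :=
  ⟨linearForm (-3) 4, by decide, by decide⟩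

theorem isPeak_genZ_three : IsPeak genZ (Sum.inl 3) :=
  ⟨linearForm 1 1, by decide, by decide⟩

/-- In `ℤ²` with generating set `{a,b,c,d}` as above, for every `n ≥ 1`
the word `a^n` (resp. `b^n`, `d^n`) is the unique geodesic word representing `(n,0)`
(resp. `(0,n)`, `(2n,2n)`); in particular the word length of `(2n,2n)` is `n`.
Consequently the cyclic subgroups `⟨a⟩`, `⟨b⟩`, `⟨d⟩` are totally geodesic in
`(ℤ², {a,b,c,d})`, and `|a| = |b| = |d| = 1`, so the presentation of Wise's group as a
multiple HNN extension associating `⟨a⟩` with `⟨d⟩` and `⟨b⟩` with `⟨d⟩` is strip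
equidistant. -/
theorem z2_unique_geodesics :
    (∀ n : ℕ, 1 ≤ n →
      (IsGeodesic genZ (List.replicate n (Sum.inl (0 : Fin 4))) ∧
        ∀ w : List (Fin 4 ⊕ Fin 4), IsGeodesic genZ w → eval genZ w = genZ 0 ^ n →
          w = List.replicate n (Sum.inl (0 : Fin 4))) ∧
      (IsGeodesic genZ (List.replicate n (Sum.inl (1 : Fin 4))) ∧
        ∀ w : List (Fin 4 ⊕ Fin 4), IsGeodesic genZ w → eval genZ w = genZ 1 ^ n →
          w = List.replicate n (Sum.inl (1 : Fin 4))) ∧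
      (IsGeodesic genZ (List.replicate n (Sum.inl (3 : Fin 4))) ∧
        ∀ w : List (Fin 4 ⊕ Fin 4), IsGeodesic genZ w → eval genZ w = genZ 3 ^ n →
          w = List.replicate n (Sum.inl (3 : Fin 4))) ∧
      wlen genZ (genZ 3 ^ n) = n) ∧
    (TGConcat genZ {genZ 0} ∧ TGConcat genZ {genZ 1} ∧ TGConcat genZ {genZ 3}) ∧
    (wlen genZ (genZ 0) = 1 ∧ wlen genZ (genZ 1) = 1 ∧ wlen genZ (genZ 3) = 1) ∧
    wlen genZ (genZ 0) = wlen genZ (genZ 3) ∧ wlen genZ (genZ 1) = wlen genZ (genZ 3) := by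
  have ha := isPeak_genZ_zero
  have hb := isPeak_genZ_one
  have hd := isPeak_genZ_three
  have wlen_one : ∀ {i : Fin 4}, IsPeak genZ (Sum.inl i) → wlen genZ (genZ i) = 1 :=
    fun {i} h => by simpa [letterEval] using h.wlen_pow 1
  refine ⟨fun n _ => ⟨⟨ha.isGeodesic_replicate n, fun w => ha.eq_replicate_of_isGeodesic⟩,
      ⟨hb.isGeodesic_replicate n, fun w => hb.eq_replicate_of_isGeodesic⟩,
      ⟨hd.isGeodesic_replicate n, fun w => hd.eq_replicate_of_isGeodesic⟩, hd.wlen_pow n⟩,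
    ⟨ha.tgConcat, hb.tgConcat, hd.tgConcat⟩, ⟨wlen_one ha, wlen_one hb, wlen_one hd⟩,
    (wlen_one ha).trans (wlen_one hd).symm, (wlen_one hb).trans (wlen_one hd).symm⟩

end ACPaper
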